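/- With f₀, h, Ω as in the context: let x = (w,y) ∈ ℝ×T³ with w ≥ w₃. Then the set of radii r ∈ (0, 3/(4w^{1/3})) such that ℋ³( ∂B_r(x) ∩ Ω ) ≤ 32·√h · 2π²r³ has positive one-dimensional Lebesgue measure; here ∂B_r(x) is the metric sphere of radius r around x in ℝ×T³, ℋ³ is three-dimensional Hausdorff measure, and 2π²r³ is the surface measure of a sphere of radius r in ℝ⁴. -/

import Mathlib

open Real MeasureTheory

noncomputable section

/-- `w_k = (27/8)·k^{3/2}`. -/
def wseq (k : ℕ) : ℝ := (27 / 8) * (k : ℝ) ^ ((3 : ℝ) / 2)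

/-- The properties of the fixed cutoff function `ζ`: smooth, `ζ = 0` on `(-∞,0]`,
`ζ = 1` on `[1,∞)`, `0 ≤ ζ ≤ 1`, `ζ' > 0` on `(0,1)`, and `ζ(t) + ζ(1-t) = 1`. -/
def IsCutoff (ζ : ℝ → ℝ) : Prop :=
  ContDiff ℝ (⊤ : ℕ∞) ζ ∧ (∀ t : ℝ, t ≤ 0 → ζ t = 0) ∧ (∀ t : ℝ, 1 ≤ t → ζ t = 1) ∧
    (∀ t : ℝ, ζ t ∈ Set.Icc (0 : ℝ) 1) ∧ (∀ t ∈ Set.Ioo (0 : ℝ) 1, 0 < deriv ζ t) ∧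
    (∀ t : ℝ, ζ t + ζ (1 - t) = 1)

/-- The properties of the fixed sequence `(a_k)` in `ℤ³`:
`|a_k|² = 4k+1` and `|a_k · a_{k+1}| ≤ |a_k||a_{k+1}|/√3` for all `k ≥ 1`. -/
def IsGoodSeq (a : ℕ → Fin 3 → ℤ) : Prop :=
  ∀ k : ℕ, 1 ≤ k →
    ((∑ i : Fin 3, (a k i) ^ 2 = 4 * (k : ℤ) + 1) ∧
      |∑ i : Fin 3, ((a k i : ℝ) * (a (k + 1) i : ℝ))| ≤
        Real.sqrt (∑ i : Fin 3, (a k i : ℝ) ^ 2) *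
          Real.sqrt (∑ i : Fin 3, (a (k + 1) i : ℝ) ^ 2) / Real.sqrt 3)

/-- The function `f₀(w,y) = Σ_{k≥2} ζ((w-w_{k-1})/(w_k-w_{k-1}))·ζ((w_{k+1}-w)/(w_{k+1}-w_k))·cos(a_k·y)`
(a locally finite sum), `2π`-periodic in each coordinate of `y`. -/
def f0 (ζ : ℝ → ℝ) (a : ℕ → Fin 3 → ℤ) (w : ℝ) (y : Fin 3 → ℝ) : ℝ :=
  ∑' k : ℕ, if 2 ≤ k then
      ζ ((w - wseq (k - 1)) / (wseq k - wseq (k - 1))) *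
        ζ ((wseq (k + 1) - w) / (wseq (k + 1) - wseq k)) *
        Real.cos (∑ i : Fin 3, (a k i : ℝ) * y i)
    else 0

/-- `h = (2e)^{-10}`. -/
def hSmall : ℝ := 1 / (2 * Real.exp 1) ^ 10

/-- `Ω = {(w,y) : w ≥ w₂, |f₀(w,y)| < 2h}`, viewed as the (2π-periodic in `y`)
subset of `ℝ × ℝ³` corresponding to a subset of `ℝ × T³`. -/
def OmegaSet (ζ : ℝ → ℝ) (a : ℕ → Fin 3 → ℤ) : Set (ℝ × (Fin 3 → ℝ)) :=
  {p | wseq 2 ≤ p.1 ∧ |f0 ζ a p.1 p.2| < 2 * hSmall}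

end

noncomputable section
open Real MeasureTheory

/-- `Ω` lifted to the universal cover `ℝ⁴` of `ℝ × T³`, where the coordinate `0` is `w`
and coordinates `1,2,3` are `y`; `ℝ⁴` carries the Euclidean metric, so that metric spheres
of radius `< π` around a point are isometric to the corresponding spheres in `ℝ × T³`. -/
def OmegaSet4 (ζ : ℝ → ℝ) (a : ℕ → Fin 3 → ℤ) : Set (EuclideanSpace ℝ (Fin 4)) :=
  {x | wseq 2 ≤ x 0 ∧ |f0 ζ a (x 0) (fun i : Fin 3 => x i.succ)| < 2 * hSmall}

open Filter Topology Metric in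
/-- A form of Eilenberg's inequality for the level sets of a `1`-Lipschitz function. -/
lemma lintegral_hausdorffMeasure_level_le {X : Type*} [MetricSpace X] [MeasurableSpace X]
    [BorelSpace X] {f : X → ℝ} (hf : LipschitzWith 1 f) {d : ℝ} (hd : 0 < d) (A : Set X) :
    ∫⁻ r, Measure.hausdorffMeasure d (A ∩ f ⁻¹' {r}) ≤ Measure.hausdorffMeasure (d + 1) A := by
  rcases eq_or_ne (Measure.hausdorffMeasure (d + 1) A) ⊤ with htop | htop
  · rw [htop]; exact le_top
  set H := Measure.hausdorffMeasure (d + 1) A with hH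
  have key : ∀ n : ℕ, ∃ t : ℕ → Set X, A ⊆ ⋃ i, t i ∧ (∀ i, ediam (t i) ≤ (n + 1 : ENNReal)⁻¹) ∧
      ∑' i, ediam (t i) ^ (d + 1) ≤ H + (n + 1 : ENNReal)⁻¹ := by
    intro n
    have hpos : (0 : ENNReal) < (n + 1 : ENNReal)⁻¹ := by
      simp [ENNReal.inv_pos]
    have h1 : (⨅ (t : ℕ → Set X) (_ : A ⊆ ⋃ n, t n) (_ : ∀ i, ediam (t i) ≤ (n + 1 : ENNReal)⁻¹),
          ∑' i, ⨆ _ : (t i).Nonempty, ediam (t i) ^ (d + 1)) < H + (n + 1 : ENNReal)⁻¹ := by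
      refine lt_of_le_of_lt ?_ (ENNReal.lt_add_right htop hpos.ne')
      rw [hH, Measure.hausdorffMeasure_apply]
      exact le_iSup₂_of_le _ hpos le_rfl
    simp only [iInf_lt_iff] at h1
    obtain ⟨t, h2, h3, h4⟩ := h1
    refine ⟨t, h2, h3, le_trans (ENNReal.tsum_le_tsum fun i => ?_) h4.le⟩
    rcases (t i).eq_empty_or_nonempty with he | hne
    · simp [he, ENNReal.zero_rpow_of_pos (by linarith : 0 < d + 1)]
    · simp [hne]
  choose t htA htd htsum using key
  have hinv : Tendsto (fun n : ℕ => (n + 1 : ENNReal)⁻¹) atTop (𝓝 0) := by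
    have := (tendsto_add_atTop_iff_nat (f := fun n : ℕ => (n : ENNReal)⁻¹) 1).2
      ENNReal.tendsto_inv_nat_nhds_zero
    simpa using this
  let J : ℕ → ℕ → Set ℝ := fun n i => toMeasurable volume (f '' t n i)
  have hJm : ∀ n i, MeasurableSet (J n i) := fun n i => measurableSet_toMeasurable _ _
  have hJv : ∀ n i, volume (J n i) ≤ ediam (t n i) := by
    intro n i
    rw [measure_toMeasurable]
    refine (Real.volume_le_diam _).trans ?_
    simpa using hf.ediam_image_le (t n i)
  let g : ℕ → ℝ → ENNReal := fun n r =>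
    ∑' i, (J n i).indicator (fun _ => ediam (t n i) ^ d) r
  have hgm : ∀ n, Measurable (g n) := fun n =>
    Measurable.tsum fun i => measurable_const.indicator (hJm n i)
  have hle : ∀ r, Measure.hausdorffMeasure d (A ∩ f ⁻¹' {r}) ≤ liminf (fun n => g n r) atTop := by
    intro r
    refine (Measure.hausdorffMeasure_le_liminf_tsum d (A ∩ f ⁻¹' {r}) (fun n : ℕ => (n + 1 : ENNReal)⁻¹) hinv
      (fun n i => t n i ∩ f ⁻¹' {r}) (Eventually.of_forall fun n i =>
        (ediam_mono (Set.inter_subset_left (s := t n i))).trans (htd n i)) (Eventually.of_forall fun n => ?_)).trans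
      (liminf_le_liminf (Eventually.of_forall fun n => ENNReal.tsum_le_tsum fun i => ?_))
    · rintro p ⟨hp, hr⟩
      obtain ⟨i, hi⟩ := Set.mem_iUnion.1 (htA n hp)
      exact Set.mem_iUnion.2 ⟨i, hi, hr⟩
    · by_cases hr : r ∈ J n i
      · simp only [Set.indicator_of_mem hr]
        exact ENNReal.rpow_le_rpow (ediam_mono (Set.inter_subset_left (s := t n i))) hd.le
      · have : t n i ∩ f ⁻¹' {r} = ∅ := by
          by_contra hne
          obtain ⟨p, hp, hpr⟩ := Set.nonempty_iff_ne_empty.2 hne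
          exact hr (subset_toMeasurable _ _ ⟨p, hp, hpr⟩)
        simp [this, ENNReal.zero_rpow_of_pos hd]
  calc ∫⁻ r, Measure.hausdorffMeasure d (A ∩ f ⁻¹' {r})
      ≤ ∫⁻ r, liminf (fun n => g n r) atTop := lintegral_mono hle
    _ ≤ liminf (fun n => ∫⁻ r, g n r) atTop := lintegral_liminf_le hgm
    _ ≤ liminf (fun n : ℕ => H + (n + 1 : ENNReal)⁻¹) atTop := by
        refine liminf_le_liminf (Eventually.of_forall fun n => ?_)
        refine le_trans ?_ (htsum n)
        rw [lintegral_tsum fun i => (measurable_const.indicator (hJm n i)).aemeasurable]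
        refine ENNReal.tsum_le_tsum fun i => ?_
        rw [lintegral_indicator (hJm n i), setLIntegral_const,
          ENNReal.rpow_add_of_nonneg _ _ hd.le zero_le_one, ENNReal.rpow_one]
        gcongr
        exact hJv n i
    _ = H := by
        have := (tendsto_const_nhds (x := H)).add hinv
        rw [add_zero] at this
        exact this.liminf_eq

lemma hausdorffMeasure_four_le (A : Set (EuclideanSpace ℝ (Fin 4))) :
    Measure.hausdorffMeasure 4 A ≤
      16 * volume ((fun v : Fin 4 → ℝ => (WithLp.toLp 2 v : EuclideanSpace ℝ (Fin 4))) ⁻¹' A) := by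
  have h := (PiLp.lipschitzWith_toLp 2 (fun _ : Fin 4 => ℝ)).hausdorffMeasure_image_le
    (d := 4) (by norm_num) (WithLp.toLp 2 ⁻¹' A)
  rw [Set.image_preimage_eq _ (WithLp.toLp_surjective 2)] at h
  refine h.trans ?_
  have h4 : (Measure.hausdorffMeasure 4 : Measure (Fin 4 → ℝ)) = volume := by
    rw [← hausdorffMeasure_pi_real]; norm_num
  rw [h4]
  gcongr
  have : ((Fintype.card (Fin 4) : NNReal) ^ (1 / (2 : ENNReal)).toReal) = 2 := by
    rw [Fintype.card_fin, show ((4 : ℕ) : NNReal) = 2 ^ (2 : ℝ) by norm_num, ← NNReal.rpow_mul]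
    norm_num
  rw [this]
  norm_num

lemma volume_le_of_abs_sub_le {E : Set ℝ} {d : ℝ} (h : ∀ x ∈ E, ∀ y ∈ E, |x - y| ≤ d) :
    volume E ≤ ENNReal.ofReal d := by
  refine (Real.volume_le_diam E).trans (Metric.ediam_le fun x hx y hy => ?_)
  rw [edist_dist, Real.dist_eq]
  exact ENNReal.ofReal_le_ofReal (h x hx y hy)

lemma exists_abs_sub_int_mul_pi_le (x : ℝ) : ∃ n : ℤ, |x - n * π| ≤ π / 2 := by
  refine ⟨round (x / π), ?_⟩
  have h := abs_sub_round (x / π)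
  have : x - round (x / π) * π = (x / π - round (x / π)) * π := by
    field_simp
  rw [this, abs_mul, abs_of_pos pi_pos]
  nlinarith [pi_pos]

lemma abs_sub_le_of_cos {x y s η : ℝ} (hx : x ∈ Set.Icc 0 π) (hy : y ∈ Set.Icc 0 π)
    (hs : 0 < s) (hxs : s ≤ sin x) (hys : s ≤ sin y) (h : |cos x - cos y| ≤ η) :
    |x - y| ≤ π * η / (2 * s) := by
  wlog hxy : x ≤ y generalizing x y
  · rw [abs_sub_comm]
    exact this hy hx hys hxs (by rwa [abs_sub_comm]) (le_of_not_ge hxy)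
  rw [abs_sub_comm, abs_of_nonneg (sub_nonneg.2 hxy)]
  have h1 : cos x - cos y = 2 * sin ((x + y) / 2) * sin ((y - x) / 2) := by
    rw [cos_sub_cos, show (x - y) / 2 = -((y - x) / 2) by ring, sin_neg]; ring
  have h2 : sin x + sin y = 2 * sin ((x + y) / 2) * cos ((y - x) / 2) := by
    rw [sin_add_sin, show (x - y) / 2 = -((y - x) / 2) by ring, cos_neg]
  have h3 := mul_le_sin (x := (y - x) / 2) (by linarith) (by linarith [hx.1, hy.2])
  have h4 : 0 ≤ sin ((x + y) / 2) :=
    sin_nonneg_of_nonneg_of_le_pi (by linarith [hx.1, hy.1]) (by linarith [hx.2, hy.2])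
  have h5 : s ≤ sin ((x + y) / 2) := by nlinarith [cos_le_one ((y - x) / 2)]
  have h6 : 2 * s * (2 / π * ((y - x) / 2)) ≤ η := by
    refine le_trans ?_ ((le_abs_self _).trans h)
    rw [h1]
    have : 0 ≤ 2 / π * ((y - x) / 2) := mul_nonneg (by positivity) (by linarith)
    gcongr
  rw [le_div_iff₀ (by positivity)]
  have h7 : 2 * s * (2 / π * ((y - x) / 2)) = (y - x) * (2 * s) / π := by field_simp
  rw [h7, div_le_iff₀ pi_pos] at h6
  linarith

lemma abs_sub_le_of_cos_sq {x y η : ℝ} (hx : x ∈ Set.Icc 0 π) (hy : y ∈ Set.Icc 0 π)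
    (hη : 0 ≤ η) (h : |cos x - cos y| ≤ 2 * η ^ 2) :
    |x - y| ≤ π * η := by
  wlog hxy : x ≤ y generalizing x y
  · rw [abs_sub_comm]
    exact this hy hx (by rwa [abs_sub_comm]) (le_of_not_ge hxy)
  rw [abs_sub_comm, abs_of_nonneg (sub_nonneg.2 hxy)]
  have h1 : cos x - cos y = 2 * sin ((x + y) / 2) * sin ((y - x) / 2) := by
    rw [cos_sub_cos, show (x - y) / 2 = -((y - x) / 2) by ring, sin_neg]; ring
  have h3 := mul_le_sin (x := (y - x) / 2) (by linarith) (by linarith [hx.1, hy.2])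
  have h4 : 0 ≤ sin ((y - x) / 2) :=
    sin_nonneg_of_nonneg_of_le_pi (by linarith) (by linarith [hx.1, hy.2, pi_pos])
  have h5 : sin ((y - x) / 2) ≤ sin ((x + y) / 2) := by
    have : 0 ≤ sin ((x + y) / 2) - sin ((y - x) / 2) := by
      rw [sin_sub_sin, show ((x + y) / 2 - (y - x) / 2) / 2 = x / 2 by ring,
        show ((x + y) / 2 + (y - x) / 2) / 2 = y / 2 by ring]
      have := sin_nonneg_of_nonneg_of_le_pi (x := x / 2) (by linarith [hx.1])
        (by linarith [hx.2, pi_pos])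
      have := cos_nonneg_of_mem_Icc (x := y / 2)
        ⟨by linarith [hy.1, pi_pos], by linarith [hy.2]⟩
      positivity
    linarith
  have h6 : sin ((y - x) / 2) ≤ η := by
    have := (le_abs_self _).trans h
    rw [h1] at this
    nlinarith
  have h7 : 2 / π * ((y - x) / 2) = (y - x) / π := by field_simp
  have h8 := h3.trans h6
  rw [h7, div_le_iff₀ pi_pos] at h8
  linarith

lemma volume_le_of_cos_separation {E : Set ℝ} {A ρ d : ℝ} (hρ : ρ ≤ π / 2)
    (hE : ∀ x ∈ E, |x - A| ≤ ρ)
    (h : ∀ x ∈ E, ∀ y ∈ E, ∀ u ∈ Set.Icc 0 π, ∀ v ∈ Set.Icc 0 π,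
      |cos x - cos y| = |cos u - cos v| → |sin x| = sin u → |sin y| = sin v → |u - v| ≤ d) :
    volume E ≤ 2 * ENNReal.ofReal d := by
  obtain ⟨n, hn⟩ := exists_abs_sub_int_mul_pi_le A
  have hmem : ∀ x ∈ E, |x - n * π| ≤ π := fun x hx => by
    have := abs_add_le (x - A) (A - n * π)
    rw [sub_add_sub_cancel] at this
    linarith [hE x hx]
  have key : ∀ x ∈ E, ∀ y ∈ E, |(|x - n * π|) - (|y - n * π|)| ≤ d := by
    intro x hx y hy
    refine h x hx y hy _ ⟨abs_nonneg _, hmem x hx⟩ _ ⟨abs_nonneg _, hmem y hy⟩ ?_ ?_ ?_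
    · rw [cos_abs, cos_abs, cos_sub_int_mul_pi, cos_sub_int_mul_pi, ← mul_sub, abs_mul]
      simp
    · rw [← abs_sin_eq_sin_abs_of_abs_le_pi (hmem x hx), sin_sub_int_mul_pi, abs_mul]
      simp
    · rw [← abs_sin_eq_sin_abs_of_abs_le_pi (hmem y hy), sin_sub_int_mul_pi, abs_mul]
      simp
  have hsub : E ⊆ (E ∩ {x | n * π ≤ x}) ∪ (E ∩ {x | x ≤ n * π}) := fun x hx =>
    (le_total (n * π) x).imp (fun h => ⟨hx, h⟩) (fun h => ⟨hx, h⟩)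
  refine (measure_mono hsub).trans ((measure_union_le _ _).trans ?_)
  rw [two_mul]
  refine add_le_add (volume_le_of_abs_sub_le ?_) (volume_le_of_abs_sub_le ?_)
  · rintro x ⟨hx, hx'⟩ y ⟨hy, hy'⟩
    have := key x hx y hy
    rw [Set.mem_ofPred_eq] at hx' hy'
    rw [abs_of_nonneg (sub_nonneg.2 hx'), abs_of_nonneg (sub_nonneg.2 hy')] at this
    simpa using this
  · rintro x ⟨hx, hx'⟩ y ⟨hy, hy'⟩
    have := key x hx y hy
    rw [Set.mem_ofPred_eq] at hx' hy'
    rw [abs_of_nonpos (sub_nonpos.2 hx'), abs_of_nonpos (sub_nonpos.2 hy'), abs_sub_comm] at this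
    simpa using this

lemma volume_abs_cos_sub_lt_le {A c q : ℝ} (hq : 0 ≤ q) :
    volume {x | |x - A| ≤ 6 / 5 ∧ |cos x - c| < 4 * q ^ 2} ≤ ENNReal.ofReal (4 * π * q) := by
  refine (volume_le_of_cos_separation (A := A) (ρ := 6 / 5) (d := π * (2 * q))
    (by linarith [pi_gt_d2]) (fun x hx => hx.1) ?_).trans ?_
  · intro x hx y hy u hu v hv h1 _ _
    refine abs_sub_le_of_cos_sq hu hv (by positivity) ?_
    rw [← h1]
    have := abs_sub_le (cos x) c (cos y)
    rw [abs_sub_comm c] at this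
    linarith [hx.2, hy.2]
  · rw [show (2 : ENNReal) = ENNReal.ofReal 2 by simp, ← ENNReal.ofReal_mul (by norm_num)]
    exact ENNReal.ofReal_le_ofReal (by linarith)

lemma volume_abs_cos_sub_lt_le_of_sin {A B c q : ℝ} (hq : 0 ≤ q) (hq' : q ≤ 1 / 4000)
    (hc : |c| ≤ |cos B|) (hB : 1 / 50 ≤ |sin B|) :
    volume {x | |x - A| ≤ 6 / 5 ∧ |cos x - c| < 4 * q ^ 2} ≤
      ENNReal.ofReal (408 * π * q ^ 2) := by
  have hsin : ∀ x, |cos x - c| < 4 * q ^ 2 → 1 / 51 ≤ |sin x| := by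
    intro x hx
    have h1 : |cos x| ≤ |cos B| + 4 * q ^ 2 := by
      have := abs_add_le (cos x - c) c
      rw [sub_add_cancel] at this
      linarith
    have h2 := abs_cos_le_one B
    have h3 : |cos x| ^ 2 ≤ (|cos B| + 4 * q ^ 2) ^ 2 := by gcongr
    have h4 : q ^ 2 ≤ (1 / 4000) ^ 2 := by gcongr
    have h5 := sin_sq_add_cos_sq x
    have h6 := sin_sq_add_cos_sq B
    rw [← sq_abs (sin B), ← sq_abs (cos B)] at h6
    rw [← sq_abs (sin x), ← sq_abs (cos x)] at h5
    have h7 : (1 / 50) ^ 2 ≤ |sin B| ^ 2 := by gcongr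
    have h8 : |cos B| * q ^ 2 ≤ q ^ 2 := mul_le_of_le_one_left (sq_nonneg _) h2
    have h9 : (q ^ 2) ^ 2 ≤ ((1 / 4000) ^ 2) ^ 2 := by gcongr
    refine le_of_sq_le_sq ?_ (abs_nonneg _)
    nlinarith
  refine (volume_le_of_cos_separation (A := A) (ρ := 6 / 5) (d := π * (8 * q ^ 2) / (2 * (1 / 51)))
    (by linarith [pi_gt_d2]) (fun x hx => hx.1) ?_).trans ?_
  · intro x hx y hy u hu v hv h1 h2 h3
    refine abs_sub_le_of_cos hu hv (by norm_num) (h2 ▸ hsin x hx.2) (h3 ▸ hsin y hy.2) ?_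
    rw [← h1]
    have := abs_sub_le (cos x) c (cos y)
    rw [abs_sub_comm c] at this
    linarith [hx.2, hy.2]
  · rw [show (2 : ENNReal) = ENNReal.ofReal 2 by simp, ← ENNReal.ofReal_mul (by norm_num)]
    exact ENNReal.ofReal_le_ofReal (le_of_eq (by ring))

lemma exists_int_of_abs_sin_lt {B : ℝ} :
    ∃ n : ℤ, ∀ x, |x - B| ≤ 6 / 5 → |sin x| < 1 / 50 → |x - n * π| ≤ π / 100 := by
  obtain ⟨n, hn⟩ := exists_abs_sub_int_mul_pi_le B
  refine ⟨n, fun x hx hs => ?_⟩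
  have h1 : |x - n * π| ≤ π / 2 + 6 / 5 := by
    have := abs_add_le (x - B) (B - n * π)
    rw [sub_add_sub_cancel] at this
    linarith
  have hpi := pi_gt_d2
  have hpi' := pi_lt_d2
  have h2 : |sin x| = sin |x - n * π| := by
    rw [← abs_sin_eq_sin_abs_of_abs_le_pi (by linarith), sin_sub_int_mul_pi, abs_mul]
    simp
  rw [h2] at hs
  rcases le_total (|x - n * π|) (π / 2) with h | h
  · have h3 := (mul_le_sin (abs_nonneg _) h).trans_lt hs
    rw [div_mul_eq_mul_div, div_lt_iff₀ pi_pos] at h3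
    linarith
  · have h3 := mul_le_sin (x := π - |x - n * π|) (by linarith) (by linarith)
    rw [sin_pi_sub] at h3
    have h4 := h3.trans_lt hs
    rw [div_mul_eq_mul_div, div_lt_iff₀ pi_pos] at h4
    linarith

lemma volume_le_mul_of_tail {n : ℕ} {T : Set (Fin (n + 1) → ℝ)} (hT : MeasurableSet T)
    {P : Set (Fin n → ℝ)} {M : ENNReal}
    (hP : ∀ (s : ℝ) (z : Fin n → ℝ), (Fin.cons s z : Fin (n + 1) → ℝ) ∈ T → z ∈ P)
    (hM : ∀ z ∈ P, volume {s : ℝ | (Fin.cons s z : Fin (n + 1) → ℝ) ∈ T} ≤ M) :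
    volume T ≤ M * volume P := by
  have e := (volume_preserving_piFinSuccAbove (fun _ : Fin (n + 1) => ℝ) 0).symm
  rw [← e.measure_preimage hT.nullMeasurableSet, Measure.volume_eq_prod,
    Measure.prod_apply_symm (e.measurable hT)]
  calc _ ≤ ∫⁻ z, (toMeasurable volume P).indicator (fun _ => M) z := by
        refine lintegral_mono fun z => ?_
        change volume {s : ℝ | (Fin.insertNth 0 s z : Fin (n + 1) → ℝ) ∈ T} ≤ _
        simp only [Fin.insertNth_zero']
        by_cases hz : z ∈ P
        · rw [Set.indicator_of_mem (subset_toMeasurable _ _ hz)]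
          exact hM z hz
        · have : {s : ℝ | (Fin.cons s z : Fin (n + 1) → ℝ) ∈ T} = ∅ :=
            Set.eq_empty_iff_forall_notMem.2 fun s hs => hz (hP s z hs)
          rw [this]
          simp
    _ = M * volume P := by
        rw [lintegral_indicator (measurableSet_toMeasurable _ _), setLIntegral_const,
          measure_toMeasurable]

lemma volume_le_mul_of_head {n : ℕ} {T : Set (Fin (n + 1) → ℝ)} (hT : MeasurableSet T)
    {P : Set ℝ} {M : ENNReal}
    (hP : ∀ (s : ℝ) (z : Fin n → ℝ), (Fin.cons s z : Fin (n + 1) → ℝ) ∈ T → s ∈ P)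
    (hM : ∀ s ∈ P, volume {z : Fin n → ℝ | (Fin.cons s z : Fin (n + 1) → ℝ) ∈ T} ≤ M) :
    volume T ≤ M * volume P := by
  have e := (volume_preserving_piFinSuccAbove (fun _ : Fin (n + 1) => ℝ) 0).symm
  rw [← e.measure_preimage hT.nullMeasurableSet, Measure.volume_eq_prod,
    Measure.prod_apply (e.measurable hT)]
  calc _ ≤ ∫⁻ z, (toMeasurable volume P).indicator (fun _ => M) z := by
        refine lintegral_mono fun s => ?_
        change volume {z : Fin n → ℝ | (Fin.insertNth 0 s z : Fin (n + 1) → ℝ) ∈ T} ≤ _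
        simp only [Fin.insertNth_zero']
        by_cases hs : s ∈ P
        · rw [Set.indicator_of_mem (subset_toMeasurable _ _ hs)]
          exact hM s hs
        · have : {z : Fin n → ℝ | (Fin.cons s z : Fin (n + 1) → ℝ) ∈ T} = ∅ :=
            Set.eq_empty_iff_forall_notMem.2 fun z hz => hs (hP s z hz)
          rw [this]
          simp
    _ = M * volume P := by
        rw [lintegral_indicator (measurableSet_toMeasurable _ _), setLIntegral_const,
          measure_toMeasurable]

lemma volume_box_two {p₀ p₁ r₀ r₁ : ℝ} (h₀ : 0 ≤ r₀) :
    volume {p : Fin 2 → ℝ | |p 0 - p₀| ≤ r₀ ∧ |p 1 - p₁| ≤ r₁} =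
      ENNReal.ofReal (2 * r₀ * (2 * r₁)) := by
  have : {p : Fin 2 → ℝ | |p 0 - p₀| ≤ r₀ ∧ |p 1 - p₁| ≤ r₁} =
      Set.pi Set.univ ![Metric.closedBall p₀ r₀, Metric.closedBall p₁ r₁] := by
    ext p
    simp [Fin.forall_fin_two, Real.dist_eq]
  rw [this, volume_pi_pi]
  simp [Fin.prod_univ_two, Real.volume_closedBall, ENNReal.ofReal_mul (by positivity : 0 ≤ 2 * r₀)]

/-- Volume of a sublevel set of `(1 - t) cos z₀ + t cos z₁` in a box. -/
lemma volume_sublevel_box_le {A B C ρ t q : ℝ} (hq : 0 ≤ q) (hq' : q ≤ 211 / 1000000)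
    (hρ : 0 ≤ ρ) (ht0 : 0 ≤ t) (ht : t ≤ 1 / 2) :
    volume {z : Fin 3 → ℝ | |z 0 - A| ≤ 6 / 5 ∧ |z 1 - B| ≤ 6 / 5 ∧ |z 2 - C| ≤ ρ ∧
      |(1 - t) * cos (z 0) + t * cos (z 1)| < 2 * q ^ 2} ≤ ENNReal.ofReal (29 / 10 * ρ * q) := by
  set T := {z : Fin 3 → ℝ | |z 0 - A| ≤ 6 / 5 ∧ |z 1 - B| ≤ 6 / 5 ∧ |z 2 - C| ≤ ρ ∧
      |(1 - t) * cos (z 0) + t * cos (z 1)| < 2 * q ^ 2} with hT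
  have hTm : MeasurableSet T := by
    refine (measurableSet_le (f := fun z : Fin 3 → ℝ => |z 0 - A|) ?_ ?_).inter <|
      (measurableSet_le (f := fun z : Fin 3 → ℝ => |z 1 - B|) ?_ ?_).inter <|
      (measurableSet_le (f := fun z : Fin 3 → ℝ => |z 2 - C|) ?_ ?_).inter <|
      measurableSet_lt (f := fun z : Fin 3 → ℝ => |(1 - t) * cos (z 0) + t * cos (z 1)|) ?_ ?_
      <;> fun_prop
  have hSm : MeasurableSet {z : Fin 3 → ℝ | |sin (z 1)| < 1 / 50} :=
    measurableSet_lt (by fun_prop) (by fun_prop)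
  have hred : ∀ y : ℝ, |t / (1 - t) * -cos y| ≤ |cos y| ∧
      ∀ x : ℝ, |(1 - t) * cos x + t * cos y| < 2 * q ^ 2 →
        |cos x - t / (1 - t) * -cos y| < 4 * q ^ 2 := by
    intro y
    have h1 : 0 < 1 - t := by linarith
    refine ⟨?_, fun x hx => ?_⟩
    · rw [abs_mul, abs_neg, abs_of_nonneg (by positivity)]
      refine mul_le_of_le_one_left (abs_nonneg _) ?_
      rw [div_le_one h1]
      linarith
    · have h2 : cos x - t / (1 - t) * -cos y = ((1 - t) * cos x + t * cos y) / (1 - t) := by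
        field_simp
        ring
      rw [h2, abs_div, abs_of_pos h1, div_lt_iff₀ h1]
      nlinarith [sq_nonneg q]
  obtain ⟨n, hn⟩ := exists_int_of_abs_sin_lt (B := B)
  have h1 : volume (T ∩ {z | |sin (z 1)| < 1 / 50}) ≤
      ENNReal.ofReal (4 * π * q) * ENNReal.ofReal (2 * (π / 100) * (2 * ρ)) := by
    rw [← volume_box_two (p₀ := n * π) (p₁ := C) (by positivity)]
    refine volume_le_mul_of_tail (hTm.inter hSm) ?_ ?_
    · rintro s z ⟨⟨-, hz1, hz2, -⟩, hz⟩
      exact ⟨hn _ hz1 hz, hz2⟩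
    · intro z _
      refine (measure_mono ?_).trans (volume_abs_cos_sub_lt_le (A := A)
        (c := t / (1 - t) * -cos (z 0)) hq)
      rintro s ⟨⟨hs, -, -, hs'⟩, -⟩
      exact ⟨hs, (hred _).2 _ hs'⟩
  have h2 : volume (T ∩ {z | |sin (z 1)| < 1 / 50}ᶜ) ≤
      ENNReal.ofReal (408 * π * q ^ 2) * ENNReal.ofReal (2 * (6 / 5) * (2 * ρ)) := by
    rw [← volume_box_two (p₀ := B) (p₁ := C) (by positivity)]
    refine volume_le_mul_of_tail (hTm.inter hSm.compl) ?_ ?_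
    · rintro s z ⟨⟨-, hz1, hz2, -⟩, -⟩
      exact ⟨hz1, hz2⟩
    · intro z _
      by_cases hz : 1 / 50 ≤ |sin (z 0)|
      · refine (measure_mono ?_).trans (volume_abs_cos_sub_lt_le_of_sin (A := A) (B := z 0)
          (c := t / (1 - t) * -cos (z 0)) hq (by linarith) (hred _).1 hz)
        rintro s ⟨⟨hs, -, -, hs'⟩, -⟩
        exact ⟨hs, (hred _).2 _ hs'⟩
      · refine le_of_eq_of_le ?_ zero_le
        rw [show {s : ℝ | (Fin.cons s z : Fin 3 → ℝ) ∈ T ∩ {z | |sin (z 1)| < 1 / 50}ᶜ} = ∅ from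
          Set.eq_empty_iff_forall_notMem.2 fun s hs => hs.2 (not_le.1 hz)]
        simp
  rw [← measure_inter_add_sdiff T hSm]
  refine (add_le_add h1 h2).trans ?_
  rw [← ENNReal.ofReal_mul (by positivity), ← ENNReal.ofReal_mul (by positivity),
    ← ENNReal.ofReal_add (by positivity) (by positivity)]
  refine ENNReal.ofReal_le_ofReal ?_
  have hπ := pi_lt_d2
  have hπ2 : π ^ 2 ≤ 9.9225 := by nlinarith [pi_pos]
  have hρq : 0 ≤ ρ * q := mul_nonneg hρ hq
  have e1 : π ^ 2 * (ρ * q) ≤ 9.9225 * (ρ * q) := by gcongr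
  have e2 : π * q * (ρ * q) ≤ 3.15 * (211 / 1000000) * (ρ * q) := by gcongr
  nlinarith

lemma volume_sublevel_ball_le_of_le_half {a b y₀ : Fin 3 → ℝ} {R t q : ℝ} (hq : 0 ≤ q)
    (hq' : q ≤ 211 / 1000000) (hR : 0 < R)
    (ha : (∑ i, a i ^ 2) * R ^ 2 ≤ (6 / 5) ^ 2) (hb : (∑ i, b i ^ 2) * R ^ 2 ≤ (6 / 5) ^ 2)
    (hD : (7 / 10) ^ 2 ≤ ((∑ i, a i ^ 2) * (∑ i, b i ^ 2) - (∑ i, a i * b i) ^ 2) * R ^ 4)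
    (ht0 : 0 ≤ t) (ht : t ≤ 1 / 2) :
    volume {y : Fin 3 → ℝ | ∑ i, (y i - y₀ i) ^ 2 ≤ R ^ 2 ∧
      |(1 - t) * cos (∑ i, a i * y i) + t * cos (∑ i, b i * y i)| < 2 * q ^ 2} ≤
      ENNReal.ofReal (29 / 7 * q * R ^ 3) := by
  set D := (∑ i, a i ^ 2) * (∑ i, b i ^ 2) - (∑ i, a i * b i) ^ 2 with hDdef
  have hDpos : 0 < D := by
    by_contra hneg
    have : D * R ^ 4 ≤ 0 := mul_nonpos_of_nonpos_of_nonneg (not_lt.1 hneg) (by positivity)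
    linarith
  let c : Fin 3 → ℝ := ![a 1 * b 2 - a 2 * b 1, a 2 * b 0 - a 0 * b 2, a 0 * b 1 - a 1 * b 0]
  have hc : ∑ i, c i ^ 2 = D := by
    simp [c, hDdef, Fin.sum_univ_three]
    ring
  let M : Matrix (Fin 3) (Fin 3) ℝ := Matrix.of ![a, b, c]
  have hdet : LinearMap.det (Matrix.toLin' M) = D := by
    rw [LinearMap.det_toLin', Matrix.det_fin_three]
    simp [M, c, hDdef, Fin.sum_univ_three]
    ring
  have hcs : ∀ (v y : Fin 3 → ℝ) (r : ℝ), 0 ≤ r → (∑ i, v i ^ 2) * R ^ 2 ≤ r ^ 2 →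
      ∑ i, (y i - y₀ i) ^ 2 ≤ R ^ 2 → |∑ i, v i * y i - ∑ i, v i * y₀ i| ≤ r := by
    intro v y r hr hv hy
    refine abs_le_of_sq_le_sq ?_ hr
    rw [← Finset.sum_sub_distrib]
    simp only [← mul_sub]
    refine (Finset.sum_mul_sq_le_sq_mul_sq _ _ _).trans (le_trans ?_ hv)
    gcongr
  have hsub : {y : Fin 3 → ℝ | ∑ i, (y i - y₀ i) ^ 2 ≤ R ^ 2 ∧
      |(1 - t) * cos (∑ i, a i * y i) + t * cos (∑ i, b i * y i)| < 2 * q ^ 2} ⊆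
      Matrix.toLin' M ⁻¹' {z : Fin 3 → ℝ | |z 0 - ∑ i, a i * y₀ i| ≤ 6 / 5 ∧
        |z 1 - ∑ i, b i * y₀ i| ≤ 6 / 5 ∧ |z 2 - ∑ i, c i * y₀ i| ≤ √D * R ∧
        |(1 - t) * cos (z 0) + t * cos (z 1)| < 2 * q ^ 2} := by
    rintro y ⟨hy, hy'⟩
    have e0 : Matrix.toLin' M y 0 = ∑ i, a i * y i := rfl
    have e1 : Matrix.toLin' M y 1 = ∑ i, b i * y i := rfl
    have e2 : Matrix.toLin' M y 2 = ∑ i, c i * y i := rfl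
    simp only [Set.mem_preimage, Set.mem_ofPred_eq, e0, e1, e2]
    refine ⟨hcs a y _ (by norm_num) ha hy, hcs b y _ (by norm_num) hb hy,
      hcs c y _ (by positivity) ?_ hy, hy'⟩
    rw [hc, mul_pow, sq_sqrt hDpos.le]
  refine (measure_mono hsub).trans ?_
  rw [Measure.addHaar_preimage_linearMap _ (by rw [hdet]; exact hDpos.ne'), hdet]
  refine (mul_le_mul_right (volume_sublevel_box_le hq hq' (by positivity) ht0 ht) _).trans ?_
  rw [← ENNReal.ofReal_mul (abs_nonneg _), abs_of_pos (inv_pos.2 hDpos)]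
  refine ENNReal.ofReal_le_ofReal ?_
  have hs : 7 / 10 ≤ √D * R ^ 2 := by
    refine le_of_sq_le_sq ?_ (by positivity)
    rw [mul_pow, sq_sqrt hDpos.le, ← pow_mul]
    exact hD
  have hsD : 0 < √D := sqrt_pos.2 hDpos
  have e : D⁻¹ * (29 / 10 * (√D * R) * q) = 29 / 10 * q * R / √D := by
    nth_rewrite 1 [← sq_sqrt hDpos.le]
    field_simp
  rw [e, div_le_iff₀ hsD]
  have : 0 ≤ q * R := by positivity
  nlinarith [mul_le_mul_of_nonneg_left hs this]

lemma volume_sublevel_ball_le {a b y₀ : Fin 3 → ℝ} {R t q : ℝ} (hq : 0 ≤ q)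
    (hq' : q ≤ 211 / 1000000) (hR : 0 < R)
    (ha : (∑ i, a i ^ 2) * R ^ 2 ≤ (6 / 5) ^ 2) (hb : (∑ i, b i ^ 2) * R ^ 2 ≤ (6 / 5) ^ 2)
    (hD : (7 / 10) ^ 2 ≤ ((∑ i, a i ^ 2) * (∑ i, b i ^ 2) - (∑ i, a i * b i) ^ 2) * R ^ 4)
    (ht : t ∈ Set.Icc 0 1) :
    volume {y : Fin 3 → ℝ | ∑ i, (y i - y₀ i) ^ 2 ≤ R ^ 2 ∧
      |(1 - t) * cos (∑ i, a i * y i) + t * cos (∑ i, b i * y i)| < 2 * q ^ 2} ≤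
      ENNReal.ofReal (29 / 7 * q * R ^ 3) := by
  rcases le_total t (1 / 2) with h | h
  · exact volume_sublevel_ball_le_of_le_half hq hq' hR ha hb hD ht.1 h
  · have := volume_sublevel_ball_le_of_le_half (t := 1 - t) (y₀ := y₀) hq hq' hR hb ha
      (by simpa only [mul_comm] using hD) (by linarith [ht.2]) (by linarith)
    simpa only [sub_sub_cancel, add_comm] using this

lemma wseq_eq (k : ℕ) : wseq k = 27 / 8 * √(k : ℝ) ^ 3 := by
  rw [wseq, sqrt_eq_rpow, ← rpow_natCast, ← rpow_mul (Nat.cast_nonneg k)]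
  norm_num

lemma wseq_strictMono : StrictMono wseq := by
  intro j k hjk
  rw [wseq_eq, wseq_eq]
  have : √(j : ℝ) < √(k : ℝ) := sqrt_lt_sqrt (Nat.cast_nonneg j) (Nat.cast_lt.2 hjk)
  gcongr

lemma exists_wseq_le_lt {w : ℝ} (hw : wseq 2 ≤ w) :
    ∃ k : ℕ, 2 ≤ k ∧ wseq k ≤ w ∧ w < wseq (k + 1) := by
  have hex : ∃ n : ℕ, w < wseq n := by
    refine ⟨(⌈w⌉₊ + 1) ^ 2, ?_⟩
    have h0 : (0 : ℝ) ≤ ⌈w⌉₊ := Nat.cast_nonneg _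
    rw [wseq_eq]
    push_cast
    rw [sqrt_sq (by positivity)]
    have := Nat.le_ceil w
    nlinarith [pow_nonneg h0 3, pow_nonneg h0 2]
  classical
  have h1 := Nat.find_spec hex
  have h2 : 2 < Nat.find hex := wseq_strictMono.lt_iff_lt.1 (hw.trans_lt h1)
  obtain ⟨k, hk⟩ : ∃ k, Nat.find hex = k + 1 := ⟨Nat.find hex - 1, by omega⟩
  refine ⟨k, by omega, not_lt.1 (Nat.find_min hex (by omega)), ?_⟩
  rwa [hk] at h1

lemma f0_eq {ζ : ℝ → ℝ} (hζ : IsCutoff ζ) (a : ℕ → Fin 3 → ℤ) {k : ℕ} (hk : 2 ≤ k) {w : ℝ}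
    (h1 : wseq k ≤ w) (h2 : w < wseq (k + 1)) (y : Fin 3 → ℝ) :
    f0 ζ a w y = (1 - ζ ((w - wseq k) / (wseq (k + 1) - wseq k))) * cos (∑ i, (a k i : ℝ) * y i) +
      ζ ((w - wseq k) / (wseq (k + 1) - wseq k)) * cos (∑ i, (a (k + 1) i : ℝ) * y i) := by
  obtain ⟨-, hz0, hz1, -, -, hsymm⟩ := hζ
  have hgap : ∀ j, 0 < wseq (j + 1) - wseq j := fun j =>
    sub_pos.2 (wseq_strictMono (Nat.lt_succ_self j))
  rw [f0, tsum_eq_sum (s := {k, k + 1}), Finset.sum_pair (by omega)]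
  · rw [if_pos hk, if_pos (by omega)]
    obtain ⟨m, rfl⟩ : ∃ m, k = m + 1 := ⟨k - 1, by omega⟩
    simp only [Nat.add_sub_cancel]
    have e1 : ζ ((w - wseq m) / (wseq (m + 1) - wseq m)) = 1 :=
      hz1 _ ((one_le_div (hgap m)).2 (by linarith))
    have e2 : ζ ((wseq (m + 1 + 1 + 1) - w) / (wseq (m + 1 + 1 + 1) - wseq (m + 1 + 1))) = 1 :=
      hz1 _ ((one_le_div (hgap _)).2 (by linarith))
    have e3 : ζ ((wseq (m + 1 + 1) - w) / (wseq (m + 1 + 1) - wseq (m + 1))) =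
        1 - ζ ((w - wseq (m + 1)) / (wseq (m + 1 + 1) - wseq (m + 1))) := by
      rw [← hsymm ((w - wseq (m + 1)) / (wseq (m + 1 + 1) - wseq (m + 1))), add_sub_cancel_left]
      congr 1
      have := (hgap (m + 1)).ne'
      field_simp
      ring
    rw [e1, e2, e3, one_mul, mul_one]
  · intro j hj
    simp only [Finset.mem_insert, Finset.mem_singleton, not_or] at hj
    split_ifs with hj2
    · obtain ⟨m, rfl⟩ : ∃ m, j = m + 1 := ⟨j - 1, by omega⟩
      simp only [Nat.add_sub_cancel]
      rcases lt_or_ge (m + 1) k with hlt | hge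
      · have : wseq (m + 1 + 1) ≤ wseq k := wseq_strictMono.monotone hlt
        rw [hz0 ((wseq (m + 1 + 1) - w) / _)
          (div_nonpos_of_nonpos_of_nonneg (by linarith) (hgap _).le)]
        ring
      · have : wseq (k + 1) ≤ wseq m := wseq_strictMono.monotone (by omega)
        rw [hz0 ((w - wseq m) / _) (div_nonpos_of_nonpos_of_nonneg (by linarith) (hgap _).le)]
        ring
    · rfl

lemma measurable_f0 {ζ : ℝ → ℝ} (hζ : IsCutoff ζ) (a : ℕ → Fin 3 → ℤ) :
    Measurable fun v : Fin 4 → ℝ => f0 ζ a (v 0) (fun i => v i.succ) := by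
  have hm : Measurable ζ := hζ.1.continuous.measurable
  refine Measurable.tsum fun k => ?_
  split_ifs
  · fun_prop
  · exact measurable_const

lemma sq_sub_sq_le_of_cube {u v m : ℝ} (hu : 0 ≤ u) (huv : u ≤ v) (hm : 0 < m)
    (h : (v ^ 3 - u ^ 3) * m ≤ 4 / 27) (h6 : 6 ≤ m * (u + v)) : v ^ 2 - u ^ 2 ≤ 1 / 25 := by
  have h1 : (v ^ 2 - u ^ 2) * (3 / 4 * (u + v)) ≤ v ^ 3 - u ^ 3 := by
    have : v ^ 3 - u ^ 3 - (v ^ 2 - u ^ 2) * (3 / 4 * (u + v)) = (v - u) * (v - u) ^ 2 / 4 := by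
      ring
    have h2 : 0 ≤ (v - u) * (v - u) ^ 2 := mul_nonneg (by linarith) (sq_nonneg _)
    linarith
  have h2 : 0 ≤ v ^ 2 - u ^ 2 := sub_nonneg.2 (pow_le_pow_left₀ hu huv 2)
  have h3 : (v ^ 2 - u ^ 2) * 6 ≤ (v ^ 2 - u ^ 2) * (m * (u + v)) :=
    mul_le_mul_of_nonneg_left h6 h2
  have h4 := mul_le_mul_of_nonneg_right h1 hm.le
  linarith

lemma exists_scale {w₀ w : ℝ} (hw₀ : wseq 3 ≤ w₀)
    (hw : |w - w₀| < 3 / (4 * w₀ ^ ((1 : ℝ) / 3))) :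
    ∃ k : ℕ, 2 ≤ k ∧ wseq k ≤ w ∧ w < wseq (k + 1) ∧
      (4 * k + 5) * (3 / (4 * w₀ ^ ((1 : ℝ) / 3))) ^ 2 ≤ (6 / 5) ^ 2 ∧
      (7 / 10) ^ 2 ≤ 2 / 3 * ((4 * k + 1) * (4 * k + 5)) *
        (3 / (4 * w₀ ^ ((1 : ℝ) / 3))) ^ 4 := by
  have h3 : wseq 3 = 27 / 8 * √(3 : ℝ) ^ 3 := wseq_eq 3
  have h2 : wseq 2 = 27 / 8 * √(2 : ℝ) ^ 3 := wseq_eq 2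
  have hw₀pos : 0 < w₀ := lt_of_lt_of_le (by rw [h3]; positivity) hw₀
  obtain ⟨s, hs⟩ : ∃ s, w₀ ^ ((1 : ℝ) / 3) = 3 / 2 * s :=
    ⟨2 / 3 * w₀ ^ ((1 : ℝ) / 3), by ring⟩
  have hspos : 0 < s := by
    have : 0 < w₀ ^ ((1 : ℝ) / 3) := by positivity
    linarith
  have hws : w₀ = 27 / 8 * s ^ 3 := by
    have : (w₀ ^ ((1 : ℝ) / 3)) ^ 3 = w₀ := by
      rw [← rpow_natCast, ← rpow_mul hw₀pos.le]
      norm_num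
    rw [← this, hs]
    ring
  have hR : 3 / (4 * w₀ ^ ((1 : ℝ) / 3)) = 1 / (2 * s) := by
    rw [hs]
    field_simp
    norm_num
  rw [hR] at hw ⊢
  have hs3 : √3 ≤ s := by
    refine le_of_pow_le_pow_left₀ (n := 3) (by norm_num) hspos.le ?_
    rw [h3, hws] at hw₀
    linarith
  have hsq3 : √(3 : ℝ) ^ 2 = 3 := sq_sqrt (by norm_num)
  have hsq2 : √(2 : ℝ) ^ 2 = 2 := sq_sqrt (by norm_num)
  have hss : 3 ≤ s ^ 2 := by
    rw [← hsq3]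
    gcongr
  have hs1 : 17 / 10 ≤ √(3 : ℝ) := le_sqrt_of_sq_le (by norm_num)
  have hs2 : √(2 : ℝ) ≤ 3 / 2 := sqrt_le_iff.2 (by norm_num)
  obtain ⟨hwl, hwu⟩ := abs_lt.1 hw
  have hRs : 1 / (2 * s) ≤ 1 / 3 := by
    gcongr
    linarith
  have hw2 : wseq 2 ≤ w := by
    have e3 : √(3 : ℝ) ^ 3 = 3 * √3 := by rw [pow_succ, hsq3]
    have e2 : √(2 : ℝ) ^ 3 = 2 * √2 := by rw [pow_succ, hsq2]
    rw [h3, e3] at hw₀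
    rw [h2, e2]
    linarith
  obtain ⟨k, hk, hk1, hk2⟩ := exists_wseq_le_lt hw2
  have hinv : 1 / (2 * s) * s = 1 / 2 := by field_simp
  have hs0 : 0 ≤ √(3 : ℝ) := sqrt_nonneg _
  have hlow : (k : ℝ) - 1 / 25 ≤ s ^ 2 := by
    by_contra! hcon
    have hp : √(k : ℝ) ^ 2 = k := sq_sqrt (Nat.cast_nonneg k)
    have hps : s ≤ √(k : ℝ) := le_sqrt_of_sq_le (by
      by_contra! hlt
      linarith)
    rw [wseq_eq] at hk1
    have e : (√(k : ℝ) ^ 3 - s ^ 3) * s ≤ 4 / 27 := by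
      have : √(k : ℝ) ^ 3 - s ^ 3 ≤ 8 / 27 * (1 / (2 * s)) := by linarith
      have := mul_le_mul_of_nonneg_right this hspos.le
      linarith
    have := sq_sub_sq_le_of_cube hspos.le hps hspos e (by
      have := mul_le_mul_of_nonneg_left hps hspos.le
      linarith)
    linarith
  have hupp : s ^ 2 ≤ (k : ℝ) + 1 + 1 / 25 := by
    by_contra! hcon
    have hp : √((k + 1 : ℕ) : ℝ) ^ 2 = k + 1 := by
      rw [sq_sqrt (Nat.cast_nonneg _)]
      push_cast
      rfl
    have hp0 : 0 ≤ √((k + 1 : ℕ) : ℝ) := sqrt_nonneg _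
    have hk' : (3 : ℝ) ≤ (k + 1 : ℕ) := by exact_mod_cast Nat.succ_le_succ hk
    have hps : √((k + 1 : ℕ) : ℝ) ≤ s := sqrt_le_iff.2 ⟨hspos.le, by push_cast; linarith⟩
    have hp3 : √3 ≤ √((k + 1 : ℕ) : ℝ) := sqrt_le_sqrt hk'
    rw [wseq_eq] at hk2
    have e : (s ^ 3 - √((k + 1 : ℕ) : ℝ) ^ 3) * s ≤ 4 / 27 := by
      have : s ^ 3 - √((k + 1 : ℕ) : ℝ) ^ 3 ≤ 8 / 27 * (1 / (2 * s)) := by linarith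
      have := mul_le_mul_of_nonneg_right this hspos.le
      linarith
    have := sq_sub_sq_le_of_cube hp0 hps hspos e (by
      have h1 := mul_le_mul hs3 hp3 hs0 hspos.le
      rw [← sq, hsq3] at h1
      linarith)
    linarith
  refine ⟨k, hk, hk1, hk2, ?_, ?_⟩
  · rw [div_pow 1, one_pow, mul_one_div, div_le_iff₀ (by positivity)]
    linarith
  · rw [div_pow 1 (2 * s), one_pow, mul_one_div, le_div_iff₀ (by positivity)]
    have : (2 * s) ^ 4 = (4 * s ^ 2) ^ 2 := by ring
    rw [this]
    have h1 : 4 * s ^ 2 - 79 / 25 ≤ 4 * k + 1 := by linarith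
    have h2 : 4 * s ^ 2 + 21 / 25 ≤ 4 * (k : ℝ) + 5 := by linarith
    have h3 : (4 * s ^ 2 - 79 / 25) * (4 * s ^ 2 + 21 / 25) ≤ (4 * k + 1) * (4 * (k : ℝ) + 5) := by
      gcongr
    nlinarith

lemma sq_sqrt_hSmall : √hSmall ^ 2 = hSmall :=
  sq_sqrt (by rw [hSmall]; positivity)

lemma sqrt_hSmall_pos : 0 < √hSmall :=
  sqrt_pos.2 (by rw [hSmall]; positivity)

lemma sqrt_hSmall_le : √hSmall ≤ 211 / 1000000 := by
  refine sqrt_le_iff.2 ⟨by norm_num, ?_⟩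
  rw [hSmall, one_div]
  refine inv_le_of_inv_le₀ (by positivity) ?_
  have h1 : (2.718 : ℝ) ≤ rexp 1 := by linarith [exp_one_gt_d9]
  calc _ ≤ ((2 : ℝ) * 2.718) ^ 10 := by norm_num
    _ ≤ _ := by gcongr

lemma IsGoodSeq.sum_sq {a : ℕ → Fin 3 → ℤ} (ha : IsGoodSeq a) {k : ℕ} (hk : 1 ≤ k) :
    ∑ i, (a k i : ℝ) ^ 2 = 4 * k + 1 := by
  exact_mod_cast (ha k hk).1

lemma IsGoodSeq.gram_ge {a : ℕ → Fin 3 → ℤ} (ha : IsGoodSeq a) {k : ℕ} (hk : 1 ≤ k) :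
    2 / 3 * ((∑ i, (a k i : ℝ) ^ 2) * ∑ i, (a (k + 1) i : ℝ) ^ 2) ≤
      (∑ i, (a k i : ℝ) ^ 2) * (∑ i, (a (k + 1) i : ℝ) ^ 2) -
        (∑ i, (a k i : ℝ) * (a (k + 1) i : ℝ)) ^ 2 := by
  have h := pow_le_pow_left₀ (abs_nonneg _) (ha k hk).2 2
  rw [sq_abs, div_pow, mul_pow, sq_sqrt (by positivity), sq_sqrt (by positivity),
    sq_sqrt (by norm_num)] at h
  linarith

lemma volume_ball_inter_le {ζ : ℝ → ℝ} (hζ : IsCutoff ζ) {a : ℕ → Fin 3 → ℤ} (ha : IsGoodSeq a)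
    (x : EuclideanSpace ℝ (Fin 4)) (hw : wseq 3 ≤ x 0) {R : ℝ} (hRpos : 0 < R)
    (hR : R = 3 / (4 * (x 0) ^ ((1 : ℝ) / 3))) :
    volume ((fun v : Fin 4 → ℝ => (WithLp.toLp 2 v : EuclideanSpace ℝ (Fin 4))) ⁻¹'
      (OmegaSet4 ζ a ∩ Metric.ball x R)) ≤ ENNReal.ofReal (58 / 7 * √hSmall * R ^ 4) := by
  let T : Set (Fin 4 → ℝ) := {v | |v 0 - x 0| < R ∧
    ∑ i : Fin 3, (v i.succ - x i.succ) ^ 2 ≤ R ^ 2 ∧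
    |f0 ζ a (v 0) (fun i : Fin 3 => v i.succ)| < 2 * hSmall}
  have hTm : MeasurableSet T := by
    refine (measurableSet_lt (f := fun v : Fin 4 → ℝ => |v 0 - x 0|) ?_ ?_).inter <|
      (measurableSet_le (f := fun v : Fin 4 → ℝ => ∑ i : Fin 3, (v i.succ - x i.succ) ^ 2)
        ?_ ?_).inter <|
      measurableSet_lt (measurable_f0 hζ a).abs ?_ <;> fun_prop
  have hsub : (fun v : Fin 4 → ℝ => (WithLp.toLp 2 v : EuclideanSpace ℝ (Fin 4))) ⁻¹'
      (OmegaSet4 ζ a ∩ Metric.ball x R) ⊆ T := by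
    rintro v ⟨hv, hball⟩
    rw [Metric.mem_ball, EuclideanSpace.dist_eq, sqrt_lt' hRpos, Fin.sum_univ_succ] at hball
    simp only [Real.dist_eq, sq_abs] at hball
    have h1 : 0 ≤ ∑ i : Fin 3, (v i.succ - x i.succ) ^ 2 := by positivity
    refine ⟨abs_lt_of_sq_lt_sq ?_ hRpos.le, ?_, hv.2⟩
    · linarith
    · linarith [sq_nonneg (v 0 - x 0)]
  refine (measure_mono hsub).trans ?_
  have hmain : volume T ≤ ENNReal.ofReal (29 / 7 * √hSmall * R ^ 3) * volume (Metric.ball (x 0) R) := by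
    refine volume_le_mul_of_head hTm (fun s z hs => hs.1) fun s hs => ?_
    rw [Metric.mem_ball, Real.dist_eq] at hs
    rw [hR] at hs
    obtain ⟨k, hk, hk1, hk2, hub, hgram⟩ := exists_scale hw hs
    rw [← hR] at hub hgram
    have hsa : ∑ i, (a k i : ℝ) ^ 2 = 4 * k + 1 := ha.sum_sq (by omega)
    have hsb : ∑ i, (a (k + 1) i : ℝ) ^ 2 = 4 * k + 5 := by
      rw [ha.sum_sq (by omega)]
      push_cast
      ring
    refine (measure_mono ?_).trans (volume_sublevel_ball_le (a := fun i => (a k i : ℝ))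
      (b := fun i => (a (k + 1) i : ℝ)) (y₀ := fun i => x i.succ)
      (t := ζ ((s - wseq k) / (wseq (k + 1) - wseq k))) sqrt_hSmall_pos.le sqrt_hSmall_le
      hRpos ?_ ?_ ?_ (hζ.2.2.2.1 _))
    · rintro z ⟨-, hz1, hz2⟩
      refine ⟨hz1, ?_⟩
      rw [sq_sqrt_hSmall, ← f0_eq hζ a hk hk1 hk2]
      exact hz2
    · rw [hsa]
      refine le_trans ?_ hub
      gcongr
      norm_num
    · rwa [hsb]
    · refine hgram.trans ?_
      gcongr
      rw [← hsa, ← hsb]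
      exact ha.gram_ge (by omega)
  refine hmain.trans (le_of_eq ?_)
  rw [Real.volume_ball, ← ENNReal.ofReal_mul (by positivity)]
  congr 1
  ring

/-- **Corollary 2.7.** Let `x = (w,y) ∈ ℝ × T³` with `w ≥ w₃`. Then the set of radii
`r ∈ (0, 3/(4w^{1/3}))` such that `ℋ³(∂B_r(x) ∩ Ω) ≤ 32√h · 2π²r³` has positive
one-dimensional Lebesgue measure. -/
theorem statement12 (ζ : ℝ → ℝ) (hζ : IsCutoff ζ) (a : ℕ → Fin 3 → ℤ) (ha : IsGoodSeq a)
    (x : EuclideanSpace ℝ (Fin 4)) (hw : wseq 3 ≤ x 0) :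
    0 < volume {r : ℝ | r ∈ Set.Ioo 0 (3 / (4 * (x 0) ^ ((1 : ℝ) / 3))) ∧
        Measure.hausdorffMeasure 3 (Metric.sphere x r ∩ OmegaSet4 ζ a) ≤
          ENNReal.ofReal (32 * Real.sqrt hSmall * (2 * π ^ 2 * r ^ 3))} := by
  obtain ⟨R, hR⟩ : ∃ R, R = 3 / (4 * (x 0) ^ ((1 : ℝ) / 3)) := ⟨_, rfl⟩
  have hx0 : 0 < x 0 := lt_of_lt_of_le (by rw [wseq_eq]; positivity) hw
  have hRpos : 0 < R := by rw [hR]; positivity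
  rw [← hR]
  by_contra hcon
  have hnull := nonpos_iff_eq_zero.1 (not_lt.1 hcon)
  have hq := sqrt_hSmall_pos
  have hae : ∀ᵐ r, r ∈ Set.Ioo 0 R →
      ENNReal.ofReal (32 * √hSmall * (2 * π ^ 2 * r ^ 3)) ≤
        Measure.hausdorffMeasure 3
          ((OmegaSet4 ζ a ∩ Metric.ball x R) ∩ (fun p => dist p x) ⁻¹' {r}) := by
    filter_upwards [measure_eq_zero_iff_ae_notMem.1 hnull] with r hr hr'
    have h1 := (not_le.1 fun h => hr ⟨hr', h⟩).le
    refine h1.trans (measure_mono ?_)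
    rintro p ⟨hp, hp'⟩
    exact ⟨⟨hp', by rw [Metric.mem_ball, hp]; exact hr'.2⟩, hp⟩
  have h_const : ∫⁻ r in Set.Ioo 0 R, ENNReal.ofReal (32 * √hSmall * (2 * π ^ 2 * r ^ 3)) =
      ENNReal.ofReal (16 * π ^ 2 * √hSmall * R ^ 4) := by
    rw [setLIntegral_congr Ioo_ae_eq_Ioc, ← ofReal_integral_eq_lintegral_ofReal,
      ← intervalIntegral.integral_of_le hRpos.le]
    · congr 1
      rw [intervalIntegral.integral_const_mul, intervalIntegral.integral_const_mul, integral_pow]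
      norm_num
      ring
    · exact (Continuous.integrableOn_Icc (by fun_prop)).mono_set Set.Ioc_subset_Icc_self
    · filter_upwards [ae_restrict_mem measurableSet_Ioc] with r hr
      have := hr.1
      positivity
  have hlip : LipschitzWith 1 fun p : EuclideanSpace ℝ (Fin 4) => dist p x :=
    LipschitzWith.dist_left x
  have hchain : ENNReal.ofReal (16 * π ^ 2 * √hSmall * R ^ 4) ≤
      16 * ENNReal.ofReal (58 / 7 * √hSmall * R ^ 4) := by
    calc _ = ∫⁻ r in Set.Ioo 0 R, ENNReal.ofReal (32 * √hSmall * (2 * π ^ 2 * r ^ 3)) := h_const.symm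
      _ ≤ ∫⁻ r in Set.Ioo 0 R, Measure.hausdorffMeasure 3
          ((OmegaSet4 ζ a ∩ Metric.ball x R) ∩ (fun p => dist p x) ⁻¹' {r}) :=
        lintegral_mono_ae ((ae_restrict_iff' measurableSet_Ioo).2 hae)
      _ ≤ ∫⁻ r, Measure.hausdorffMeasure 3
          ((OmegaSet4 ζ a ∩ Metric.ball x R) ∩ (fun p => dist p x) ⁻¹' {r}) :=
        setLIntegral_le_lintegral _ _
      _ ≤ Measure.hausdorffMeasure (3 + 1) (OmegaSet4 ζ a ∩ Metric.ball x R) :=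
        lintegral_hausdorffMeasure_level_le hlip (by norm_num) _
      _ = Measure.hausdorffMeasure 4 (OmegaSet4 ζ a ∩ Metric.ball x R) := by norm_num
      _ ≤ _ := hausdorffMeasure_four_le _
      _ ≤ _ := mul_le_mul_right (volume_ball_inter_le hζ ha x hw hRpos hR) _
  rw [show (16 : ENNReal) = ENNReal.ofReal 16 by simp, ← ENNReal.ofReal_mul (by norm_num),
    ENNReal.ofReal_le_ofReal_iff (by positivity)] at hchain
  have hpos : 0 < √hSmall * R ^ 4 := by positivity
  have hπ : 9 < π ^ 2 := by nlinarith [pi_gt_three]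
  nlinarith

end
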